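/- arXiv:2504.03158 — 6 statements merged into one kernel-verified Lean document; each statement's English description precedes it below -/
import Mathlib

section
/- Energy stability of the AEGD scheme (Proposition 2.1): Let d ∈ ℕ, τ > 0, and let g ∈ ℝ^d, r^n ∈ ℝ, z^n ∈ ℝ^d be given. Suppose z^{n+1} ∈ ℝ^d and r^{n+1} ∈ ℝ satisfy the AEGD update equations (z^{n+1} − z^n)/τ = −2 r^{n+1} g and (r^{n+1} − r^n)/τ = g · ((z^{n+1} − z^n)/τ). Then (r^{n+1})² − (r^n)² ≤ −(1/τ) ‖z^{n+1} − z^n‖². -/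
open scoped InnerProductSpace

/-- Energy stability of the AEGD scheme (Proposition 2.1). -/
theorem aegd_energy_stability {d : ℕ} (τ : ℝ) (hτ : 0 < τ)
    (g : EuclideanSpace ℝ (Fin d)) (rn rn1 : ℝ) (zn zn1 : EuclideanSpace ℝ (Fin d))
    (h1 : (1 / τ) • (zn1 - zn) = (-(2 * rn1)) • g)
    (h2 : (rn1 - rn) / τ = ⟪g, (1 / τ) • (zn1 - zn)⟫_ℝ) :
    rn1 ^ 2 - rn ^ 2 ≤ -(1 / τ) * ‖zn1 - zn‖ ^ 2 := by
  have hz : zn1 - zn = (-(2 * rn1 * τ)) • g := by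
    have h := congrArg (τ • ·) h1
    simp only [smul_smul, mul_one_div_cancel hτ.ne', one_smul] at h
    rw [h]
    congr 1
    ring
  have hr : rn1 - rn = -(2 * rn1 * τ) * ‖g‖ ^ 2 := by
    rw [h1, inner_smul_right, real_inner_self_eq_norm_sq, div_eq_iff hτ.ne'] at h2
    rw [h2]
    ring
  have hn : -(1 / τ) * ‖zn1 - zn‖ ^ 2 = 2 * rn1 * (rn1 - rn) := by
    rw [hz, norm_smul, mul_pow, Real.norm_eq_abs, sq_abs, hr]
    field_simp
  rw [hn]
  nlinarith [sq_nonneg (rn1 - rn)]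
end

section
/- Exact dissipation identity for the AEGD scheme: Let d ∈ ℕ, τ > 0, g ∈ ℝ^d, r^n, r^{n+1} ∈ ℝ, z^n, z^{n+1} ∈ ℝ^d satisfy (z^{n+1} − z^n)/τ = −2 r^{n+1} g and (r^{n+1} − r^n)/τ = g · ((z^{n+1} − z^n)/τ). Then (r^{n+1})² − (r^n)² = −(1/τ) ‖z^{n+1} − z^n‖² − (r^{n+1} − r^n)². -/
open scoped InnerProductSpace

/-- Exact dissipation identity for the AEGD scheme. -/
theorem aegd_exact_dissipation {d : ℕ} (τ : ℝ) (hτ : 0 < τ)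
    (g : EuclideanSpace ℝ (Fin d)) (rn rn1 : ℝ) (zn zn1 : EuclideanSpace ℝ (Fin d))
    (h1 : (1 / τ) • (zn1 - zn) = (-(2 * rn1)) • g)
    (h2 : (rn1 - rn) / τ = ⟪g, (1 / τ) • (zn1 - zn)⟫_ℝ) :
    rn1 ^ 2 - rn ^ 2 = -(1 / τ) * ‖zn1 - zn‖ ^ 2 - (rn1 - rn) ^ 2 := by
  have hw : zn1 - zn = (τ * -(2 * rn1)) • g := by
    rw [mul_smul, ← h1, smul_smul, mul_one_div_cancel hτ.ne', one_smul]
  rw [h1, real_inner_smul_right, real_inner_self_eq_norm_sq, div_eq_iff hτ.ne'] at h2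
  have hn : ‖zn1 - zn‖ ^ 2 = (τ * -(2 * rn1)) ^ 2 * ‖g‖ ^ 2 := by
    rw [hw, norm_smul, mul_pow, Real.norm_eq_abs, sq_abs]
  have hd : 1 / τ * ‖zn1 - zn‖ ^ 2 = 4 * τ * rn1 ^ 2 * ‖g‖ ^ 2 := by
    rw [hn]
    field_simp
    ring
  linear_combination 2 * rn1 * h2 + hd
end

section
/- Continuous-time dissipation of the modified energy for the ImEQ system (3.4): Let q : ℝ^d → ℝ and H : ℝ^d → ℝ be differentiable, and let z : ℝ → ℝ^d, r : ℝ → ℝ be differentiable curves satisfying ż(t) = −∇H(z(t)) − 2 r(t) ∇q(z(t)) and ṙ(t) = ∇q(z(t)) · ż(t) for all t. Then for all t, (d/dt) ( r(t)² + H(z(t)) ) = −‖ż(t)‖². -/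
open scoped InnerProductSpace

/-- Continuous-time dissipation of the modified energy `r² + H(z)` for the ImEQ system
`ż = -∇H(z) - 2 r ∇q(z)`, `ṙ = ∇q(z) · ż`. -/
theorem imeq_modified_energy_dissipation {d : ℕ}
    (q H : EuclideanSpace ℝ (Fin d) → ℝ) (hq : Differentiable ℝ q) (hH : Differentiable ℝ H)
    (z : ℝ → EuclideanSpace ℝ (Fin d)) (r : ℝ → ℝ)
    (hz : Differentiable ℝ z) (hr : Differentiable ℝ r)
    (hzeq : ∀ t, deriv z t = -gradient H (z t) - (2 * r t) • gradient q (z t))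
    (hreq : ∀ t, deriv r t = ⟪gradient q (z t), deriv z t⟫_ℝ) :
    ∀ t, deriv (fun s => (r s) ^ 2 + H (z s)) t = -‖deriv z t‖ ^ 2 := by
  intro t
  have hHz : HasDerivAt (fun s => H (z s)) ⟪gradient H (z t), deriv z t⟫_ℝ t := by
    have h := (hH (z t)).hasGradientAt.hasFDerivAt.comp_hasDerivAt t (hz t).hasDerivAt
    simpa [Function.comp_def] using h
  have hgrad : gradient H (z t) = -deriv z t - (2 * r t) • gradient q (z t) := by
    rw [hzeq t]
    abel
  have hsum := ((hr t).hasDerivAt.pow 2).add hHz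
  refine hsum.deriv.trans ?_
  rw [hreq t, hgrad, inner_sub_left, inner_neg_left, real_inner_smul_left,
    real_inner_self_eq_norm_sq]
  push_cast
  ring
end

section
/- Unconditional energy stability of the ImEQ scheme in the modified energy (Proposition 3.1, stability part): Let d ∈ ℕ, τ > 0, g ∈ ℝ^d, r^n ∈ ℝ, z^n ∈ ℝ^d, and let H : ℝ^d → ℝ be convex and twice continuously differentiable. Suppose z^{n+1} ∈ ℝ^d and r^{n+1} ∈ ℝ satisfy the ImEQ update equations (z^{n+1} − z^n)/τ = −∇H(z^{n+1}) − 2 r^{n+1} g and (r^{n+1} − r^n)/τ = g · ((z^{n+1} − z^n)/τ). Then (r^{n+1})² + H(z^{n+1}) ≤ (r^n)² + H(z^n). -/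
open scoped InnerProductSpace

/-- A convex function lies above its tangent plane at a point of differentiability. -/
theorem ConvexOn.add_inner_gradient_le {E : Type*} [NormedAddCommGroup E]
    [InnerProductSpace ℝ E] [CompleteSpace E] {f : E → ℝ} (hf : ConvexOn ℝ Set.univ f) {x : E}
    (hx : DifferentiableAt ℝ f x) (y : E) :
    f x + ⟪gradient f x, y - x⟫_ℝ ≤ f y := by
  have hconv : ConvexOn ℝ Set.univ (f ∘ AffineMap.lineMap (k := ℝ) x y) := by
    simpa using hf.comp_affineMap (AffineMap.lineMap (k := ℝ) x y)
  have hderiv : HasDerivAt (f ∘ AffineMap.lineMap (k := ℝ) x y)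
      ⟪gradient f x, y - x⟫_ℝ 0 := by
    have hgrad : HasFDerivAt f (InnerProductSpace.toDual ℝ E (gradient f x))
        (AffineMap.lineMap (k := ℝ) x y 0) := by
      simpa using hx.hasGradientAt.hasFDerivAt
    simpa using hgrad.comp_hasDerivAt (0 : ℝ) AffineMap.hasDerivAt_lineMap
  have hslope := hconv.le_slope_of_hasDerivAt (Set.mem_univ 0) (Set.mem_univ 1) one_pos hderiv
  simp only [slope_def_field, Function.comp_apply, AffineMap.lineMap_apply_zero,
    AffineMap.lineMap_apply_one, sub_zero, div_one] at hslope
  linarith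

/-- Unconditional energy stability of the ImEQ scheme in the modified energy
`F̃(z, r) = r² + H(z)` (Proposition 3.1, stability part). -/
theorem imeq_unconditional_energy_stability {d : ℕ} (τ : ℝ) (hτ : 0 < τ)
    (g : EuclideanSpace ℝ (Fin d)) (rn rn1 : ℝ) (zn zn1 : EuclideanSpace ℝ (Fin d))
    (H : EuclideanSpace ℝ (Fin d) → ℝ)
    (hHconv : ConvexOn ℝ Set.univ H) (hHsmooth : ContDiff ℝ 2 H)
    (h1 : (1 / τ) • (zn1 - zn) = -gradient H zn1 - (2 * rn1) • g)
    (h2 : (rn1 - rn) / τ = ⟪g, (1 / τ) • (zn1 - zn)⟫_ℝ) :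
    rn1 ^ 2 + H zn1 ≤ rn ^ 2 + H zn := by
  have htangent := hHconv.add_inner_gradient_le
    (hHsmooth.differentiable two_ne_zero).differentiableAt (x := zn1) zn
  set v := (1 / τ) • (zn1 - zn) with hv
  have hstep : zn - zn1 = -(τ • v) := by
    rw [hv, smul_smul, mul_one_div_cancel hτ.ne', one_smul, neg_sub]
  rw [hstep, inner_neg_right, real_inner_smul_right] at htangent
  have hinner : ⟪v, v⟫_ℝ = -⟪gradient H zn1, v⟫_ℝ - 2 * rn1 * ⟪g, v⟫_ℝ := by
    have h := congrArg (fun w => ⟪w, v⟫_ℝ) h1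
    simpa only [inner_sub_left, inner_neg_left, real_inner_smul_left] using h
  have hr : rn1 - rn = τ * ⟪g, v⟫_ℝ := by
    rw [← h2, mul_div_cancel₀ _ hτ.ne']
  have hdissip : 0 ≤ τ * ⟪v, v⟫_ℝ := mul_nonneg hτ.le real_inner_self_nonneg
  rw [hinner] at hdissip
  have hsq : rn1 ^ 2 - rn ^ 2 = 2 * rn1 * (τ * ⟪g, v⟫_ℝ) - (rn1 - rn) ^ 2 := by
    rw [← hr]; ring
  nlinarith [sq_nonneg (rn1 - rn)]
end

section
/- Quantitative dissipation estimate for the ImEQ scheme: Let d ∈ ℕ, τ > 0, g ∈ ℝ^d, r^n ∈ ℝ, z^n ∈ ℝ^d, and let H : ℝ^d → ℝ be convex and twice continuously differentiable. Suppose z^{n+1} ∈ ℝ^d and r^{n+1} ∈ ℝ satisfy (z^{n+1} − z^n)/τ = −∇H(z^{n+1}) − 2 r^{n+1} g and r^{n+1} − r^n = g · (z^{n+1} − z^n). Then (r^{n+1})² − (r^n)² + (r^{n+1} − r^n)² + H(z^{n+1}) − H(z^n) ≤ −(1/τ) ‖z^{n+1} − z^n‖². -/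
open scoped InnerProductSpace

/-- First-order characterization of convexity: a convex function lies above its tangent
hyperplanes. -/
theorem ConvexOn.sub_le_inner_gradient {E : Type*} [NormedAddCommGroup E] [InnerProductSpace ℝ E]
    [CompleteSpace E] {f : E → ℝ} (hf : ConvexOn ℝ Set.univ f) {x : E}
    (hx : DifferentiableAt ℝ f x) (y : E) : f x - f y ≤ ⟪gradient f x, x - y⟫_ℝ := by
  have hline : HasDerivAt (fun t : ℝ => AffineMap.lineMap x y t) (y - x) 0 :=
    AffineMap.hasDerivAt_lineMap
  have hconv : ConvexOn ℝ Set.univ (f ∘ AffineMap.lineMap (k := ℝ) x y) := by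
    simpa using hf.comp_affineMap (AffineMap.lineMap (k := ℝ) x y)
  have hderiv : HasDerivAt (f ∘ AffineMap.lineMap (k := ℝ) x y) ⟪gradient f x, y - x⟫_ℝ 0 := by
    have hgrad : HasFDerivAt f (InnerProductSpace.toDual ℝ E (gradient f x))
        (AffineMap.lineMap x y (0 : ℝ)) := by
      simpa using hx.hasGradientAt.hasFDerivAt
    simpa using hgrad.comp_hasDerivAt (0 : ℝ) hline
  have hslope := hconv.le_slope_of_hasDerivAt (Set.mem_univ 0) (Set.mem_univ 1) one_pos hderiv
  rw [← neg_sub y x, inner_neg_right]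
  simp only [slope_def_field, Function.comp_apply, AffineMap.lineMap_apply_zero,
    AffineMap.lineMap_apply_one, sub_zero, div_one] at hslope
  linarith

/-- Quantitative dissipation estimate for the ImEQ scheme. -/
theorem imeq_quantitative_dissipation {d : ℕ} (τ : ℝ) (hτ : 0 < τ)
    (g : EuclideanSpace ℝ (Fin d)) (rn rn1 : ℝ) (zn zn1 : EuclideanSpace ℝ (Fin d))
    (H : EuclideanSpace ℝ (Fin d) → ℝ)
    (hHconv : ConvexOn ℝ Set.univ H) (hHsmooth : ContDiff ℝ 2 H)
    (h1 : (1 / τ) • (zn1 - zn) = -gradient H zn1 - (2 * rn1) • g)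
    (h2 : rn1 - rn = ⟪g, zn1 - zn⟫_ℝ) :
    rn1 ^ 2 - rn ^ 2 + (rn1 - rn) ^ 2 + H zn1 - H zn ≤ -(1 / τ) * ‖zn1 - zn‖ ^ 2 := by
  have hH := hHconv.sub_le_inner_gradient (hHsmooth.differentiable two_ne_zero zn1) zn
  have htest := congrArg (fun v => ⟪v, zn1 - zn⟫_ℝ) h1
  simp only [inner_sub_left (𝕜 := ℝ) (-gradient H zn1), inner_neg_left, real_inner_smul_left,
    real_inner_self_eq_norm_sq, ← h2] at htest
  linarith
end

section
/- Existence and uniqueness of the ImEQ update (Proposition 3.1, existence part): Let d ∈ ℕ, τ > 0, g ∈ ℝ^d, r^n ∈ ℝ, z^n ∈ ℝ^d, and let H : ℝ^d → ℝ be convex, twice continuously differentiable, and bounded from below. Set B = I + 2τ g g^T and J(z) = (1/(2τ)) (z − z^n)^T B (z − z^n) + H(z) + 2 r^n g · (z − z^n). Then J is strictly convex and coercive (J(z) → ∞ as ‖z‖ → ∞), and therefore J admits a unique global minimizer z^{n+1} ∈ ℝ^d. -/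
open scoped InnerProductSpace

section QuadraticPerturbation

variable {E : Type*} [NormedAddCommGroup E]

theorem ConvexOn.strictConvexOn_add_mul_norm_sub_sq [InnerProductSpace ℝ E] {s : Set E}
    {f : E → ℝ} (hf : ConvexOn ℝ s f) {c : ℝ} (hc : 0 < c) (a : E) :
    StrictConvexOn ℝ s (fun z => f z + c * ‖z - a‖ ^ 2) := by
  have h : StrongConvexOn s (2 * c) (fun z => f z + c * ‖z - a‖ ^ 2) := by
    rw [strongConvexOn_iff_convex]
    have hlin : ConvexOn ℝ s (fun z => -(2 * c) * ⟪a, z⟫_ℝ) :=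
      ((-(2 * c)) • innerₛₗ ℝ a).convexOn hf.1
    refine ((hf.add hlin).add_const (c * ‖a‖ ^ 2)).congr fun z _ => ?_
    simp only [Pi.add_apply, norm_sub_sq_real, real_inner_comm a z]
    ring
  exact h.strictConvexOn (by positivity)

theorem tendsto_cobounded_add_mul_norm_sub_sq {f : E → ℝ} (hf : BddBelow (Set.range f))
    {c : ℝ} (hc : 0 < c) (a : E) :
    Filter.Tendsto (fun z => f z + c * ‖z - a‖ ^ 2) (Bornology.cobounded E) Filter.atTop := by
  obtain ⟨m, hm⟩ := hf
  refine Filter.tendsto_atTop_add_left_of_le _ m (fun z => hm ⟨z, rfl⟩) ?_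
  refine Filter.Tendsto.const_mul_atTop hc ((Filter.tendsto_pow_atTop two_ne_zero).comp ?_)
  refine Filter.tendsto_atTop_mono (fun z => norm_sub_norm_le z a) ?_
  simpa only [sub_eq_add_neg] using
    Filter.tendsto_atTop_add_const_right _ (-‖a‖) tendsto_norm_cobounded_atTop

theorem StrictConvexOn.existsUnique_forall_le [NormedSpace ℝ E] [ProperSpace E] {f : E → ℝ}
    (hf : StrictConvexOn ℝ Set.univ f) (hcont : Continuous f)
    (hlim : Filter.Tendsto f (Bornology.cobounded E) Filter.atTop) :
    ∃! x, ∀ y, f x ≤ f y := by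
  obtain ⟨x, hx⟩ := hcont.exists_forall_le (Metric.cobounded_eq_cocompact (α := E) ▸ hlim)
  exact ⟨x, hx, fun y hy => hf.eq_of_isMinOn (fun z _ => hy z) (fun z _ => hx z)
    (Set.mem_univ y) (Set.mem_univ x)⟩

end QuadraticPerturbation

/-- Existence and uniqueness of the ImEQ update (Proposition 3.1, existence part):
the objective `J` is strictly convex and coercive, hence admits a unique global
minimizer. Here `B x = x + 2τ (g · x) g` realizes the matrix `I + 2τ g gᵀ`. -/
theorem imeq_existence_uniqueness {d : ℕ} (τ : ℝ) (hτ : 0 < τ)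
    (g : EuclideanSpace ℝ (Fin d)) (rn : ℝ) (zn : EuclideanSpace ℝ (Fin d))
    (H : EuclideanSpace ℝ (Fin d) → ℝ)
    (hHconv : ConvexOn ℝ Set.univ H) (hHsmooth : ContDiff ℝ 2 H)
    (hHbdd : BddBelow (Set.range H))
    (B : EuclideanSpace ℝ (Fin d) → EuclideanSpace ℝ (Fin d))
    (hB : B = fun x => x + (2 * τ * ⟪g, x⟫_ℝ) • g)
    (J : EuclideanSpace ℝ (Fin d) → ℝ)
    (hJ : J = fun z => (1 / (2 * τ)) * ⟪z - zn, B (z - zn)⟫_ℝ + H z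
      + 2 * rn * ⟪g, z - zn⟫_ℝ) :
    StrictConvexOn ℝ Set.univ J ∧
    Filter.Tendsto J (Filter.comap (fun z => ‖z‖) Filter.atTop) Filter.atTop ∧
    ∃! zs : EuclideanSpace ℝ (Fin d), ∀ z, J zs ≤ J z := by
  have hc : 0 < 1 / (2 * τ) := by positivity
  set K : EuclideanSpace ℝ (Fin d) → ℝ :=
    fun z => H z + ((⟪g, z - zn⟫_ℝ + rn) ^ 2 - rn ^ 2) with hK
  have hJK : J = fun z => K z + 1 / (2 * τ) * ‖z - zn‖ ^ 2 := by
    subst hJ hB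
    funext z
    simp only [hK, inner_add_right, inner_smul_right, real_inner_self_eq_norm_sq,
      real_inner_comm g (z - zn)]
    field_simp
    ring
  have hKconv : ConvexOn ℝ Set.univ K := by
    have hlin : ConvexOn ℝ Set.univ
        (fun z : EuclideanSpace ℝ (Fin d) => (⟪g, z⟫_ℝ + (rn - ⟪g, zn⟫_ℝ)) ^ 2) :=
      ((even_two.convexOn_pow (𝕜 := ℝ)).translate_left (rn - ⟪g, zn⟫_ℝ)).comp_linearMap
        (innerₛₗ ℝ g)
    refine hHconv.add ((hlin.add_const (-rn ^ 2)).congr fun z _ => ?_)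
    simp only [Pi.add_apply, inner_sub_right]
    ring
  have hKbdd : BddBelow (Set.range K) := by
    obtain ⟨m, hm⟩ := hHbdd
    refine ⟨m - rn ^ 2, ?_⟩
    rintro _ ⟨z, rfl⟩
    have hz : m ≤ H z := hm ⟨z, rfl⟩
    simp only [hK]
    nlinarith [sq_nonneg (⟪g, z - zn⟫_ℝ + rn)]
  have hJcont : Continuous J := by
    have := hHsmooth.continuous
    rw [hJK]
    fun_prop
  have hconv : StrictConvexOn ℝ Set.univ J :=
    hJK ▸ hKconv.strictConvexOn_add_mul_norm_sub_sq hc zn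
  have hlim : Filter.Tendsto J (Bornology.cobounded _) Filter.atTop :=
    hJK ▸ tendsto_cobounded_add_mul_norm_sub_sq hKbdd hc zn
  exact ⟨hconv, comap_norm_atTop (E := EuclideanSpace ℝ (Fin d)) ▸ hlim,
    hconv.existsUnique_forall_le hJcont hlim⟩
end
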